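/- arXiv:1004.0196 — 3 statements merged into one kernel-verified Lean document; each statement's English description precedes it below -/
import Mathlib

section
/- Let Φ be an entanglement-breaking channel from T(H_A) to T(H_B), given by Φ(ρ) = ∫_X ρ_B(x) μ_ρ(dx) with μ_ρ(E) = Tr(ρ M_A(E)) for a POVM M_A and a Borel family of states ρ_B(x). Then the Choi–Jamiolkowski form of Φ is given by a bounded positive operator Ω_Φ on H_B ⊗ H_A which is separable (lies in the weak closure of convex combinations of ρ ⊗ M products) and satisfies ‖Ω_Φ‖ ≤ 1. -/
open scoped InnerProductSpace ComplexOrder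

noncomputable def rankOne {H : Type*} [NormedAddCommGroup H] [InnerProductSpace ℂ H]
    (ψ φ : H) : H →L[ℂ] H := (innerSL ℂ φ).smulRight ψ

noncomputable def conjVec {H : Type*} [NormedAddCommGroup H] [InnerProductSpace ℂ H]
    [CompleteSpace H] (e : HilbertBasis ℕ ℂ H) (ψ : H) : H :=
  ∑' i, (starRingEnd ℂ ⟪e i, ψ⟫_ℂ) • (e i)

open Filter Topology

section ConjVec

variable {H : Type*} [NormedAddCommGroup H] [InnerProductSpace ℂ H] [CompleteSpace H]

theorem conjVec_eq_repr_symm (e : HilbertBasis ℕ ℂ H) (ψ : H) :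
    conjVec e ψ = e.repr.symm (star (e.repr ψ)) := by
  rw [conjVec, ← (e.hasSum_repr_symm (star (e.repr ψ))).tsum_eq]
  simp [e.repr_apply_apply]

theorem inner_basis_conjVec (e : HilbertBasis ℕ ℂ H) (i : ℕ) (ψ : H) :
    ⟪e i, conjVec e ψ⟫_ℂ = ⟪ψ, e i⟫_ℂ := by
  rw [← e.repr_apply_apply, conjVec_eq_repr_symm]
  simp [e.repr_apply_apply]

theorem conjVec_add (e : HilbertBasis ℕ ℂ H) (ψ φ : H) :
    conjVec e (ψ + φ) = conjVec e ψ + conjVec e φ := by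
  simp [conjVec_eq_repr_symm]

theorem conjVec_smul (e : HilbertBasis ℕ ℂ H) (c : ℂ) (ψ : H) :
    conjVec e (c • ψ) = starRingEnd ℂ c • conjVec e ψ := by
  simp [conjVec_eq_repr_symm]

theorem conjVec_conjVec (e : HilbertBasis ℕ ℂ H) (ψ : H) : conjVec e (conjVec e ψ) = ψ := by
  simp [conjVec_eq_repr_symm]

theorem norm_conjVec (e : HilbertBasis ℕ ℂ H) (ψ : H) : ‖conjVec e ψ‖ = ‖ψ‖ := by
  simp [conjVec_eq_repr_symm]

theorem inner_conjVec_conjVec (e : HilbertBasis ℕ ℂ H) (ψ φ : H) :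
    ⟪conjVec e ψ, conjVec e φ⟫_ℂ = ⟪φ, ψ⟫_ℂ := by
  rw [← e.tsum_inner_mul_inner, ← e.tsum_inner_mul_inner φ ψ]
  refine tsum_congr fun i => ?_
  rw [inner_basis_conjVec, ← inner_conj_symm, inner_basis_conjVec, inner_conj_symm, mul_comm]

/-- The operator `J T J`, where `J` is the complex conjugation `conjVec e`. -/
noncomputable def conjOp (e : HilbertBasis ℕ ℂ H) (T : H →L[ℂ] H) : H →L[ℂ] H :=
  LinearMap.mkContinuous
    { toFun := fun ψ => conjVec e (T (conjVec e ψ))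
      map_add' := fun ψ φ => by simp [conjVec_add]
      map_smul' := fun c ψ => by simp [conjVec_smul] }
    ‖T‖ fun ψ => by
      simpa [norm_conjVec] using T.le_opNorm (conjVec e ψ)

theorem conjOp_apply (e : HilbertBasis ℕ ℂ H) (T : H →L[ℂ] H) (ψ : H) :
    conjOp e T ψ = conjVec e (T (conjVec e ψ)) := rfl

theorem inner_conjOp (e : HilbertBasis ℕ ℂ H) (T : H →L[ℂ] H) (ψ φ : H) :
    ⟪conjOp e T ψ, φ⟫_ℂ = ⟪conjVec e φ, T (conjVec e ψ)⟫_ℂ := by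
  rw [conjOp_apply, ← inner_conjVec_conjVec e, conjVec_conjVec]

theorem ContinuousLinearMap.IsPositive.conjOp (e : HilbertBasis ℕ ℂ H) {T : H →L[ℂ] H}
    (hT : T.IsPositive) : (conjOp e T).IsPositive := by
  refine (ContinuousLinearMap.isPositive_iff _).2 ⟨fun x y => ?_, fun x => ?_⟩
  · change ⟪_root_.conjOp e T x, y⟫_ℂ = ⟪x, _root_.conjOp e T y⟫_ℂ
    rw [inner_conjOp, ← inner_conj_symm x, inner_conjOp, inner_conj_symm,
      hT.inner_left_eq_inner_right]
  · rw [inner_conjOp]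
    exact hT.inner_nonneg_right _

end ConjVec

section Positive

variable {H : Type*} [NormedAddCommGroup H] [InnerProductSpace ℂ H] [CompleteSpace H]

theorem ContinuousLinearMap.IsPositive.exists_sqrt {T : H →L[ℂ] H} (hT : T.IsPositive) :
    ∃ S : H →L[ℂ] H, S.IsPositive ∧ S * S = T := by
  rw [← ContinuousLinearMap.nonneg_iff_isPositive] at hT
  exact ⟨CFC.sqrt T, (ContinuousLinearMap.nonneg_iff_isPositive _).1 (CFC.sqrt_nonneg T),
    CFC.sqrt_mul_sqrt_self T hT⟩

theorem isPositive_one_sub_of_hasSum_trace {ι : Type*} (g : HilbertBasis ι ℂ H) {T : H →L[ℂ] H}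
    (hT : T.IsPositive) (htr : HasSum (fun k => ⟪g k, T (g k)⟫_ℂ) 1) :
    (1 - T).IsPositive := by
  obtain ⟨S, hS, rfl⟩ := hT.exists_sqrt
  have key : ∀ x, ⟪x, (S * S) x⟫_ℂ = ((‖S x‖ ^ 2 : ℝ) : ℂ) := fun x => by
    rw [mul_apply_eq_comp, ← hS.inner_left_eq_inner_right,
      inner_self_eq_norm_sq_to_K]
    simp
  simp only [key] at htr
  have htr' : HasSum (fun k => ‖S (g k)‖ ^ 2) 1 :=
    Complex.hasSum_ofReal.1 (by simpa using htr)
  have hle : ∀ x, ‖S x‖ ^ 2 ≤ ‖x‖ ^ 2 := fun x => by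
    have h1 : HasSum (fun k => ‖⟪S (g k), x⟫_ℂ‖ ^ 2) (‖S x‖ ^ 2) := by
      have := g.hasSum_inner_mul_inner (S x) (S x)
      rw [inner_self_eq_norm_sq_to_K] at this
      have h2 : ∀ k, ⟪S x, g k⟫_ℂ * ⟪g k, S x⟫_ℂ = ((‖⟪S (g k), x⟫_ℂ‖ ^ 2 : ℝ) : ℂ) := fun k => by
        rw [← hS.inner_left_eq_inner_right (g k), ← inner_conj_symm (S x),
          ← hS.inner_left_eq_inner_right (g k), Complex.conj_mul']
        simp
      simp only [h2] at this
      exact Complex.hasSum_ofReal.1 (by simpa using this)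
    have h3 := htr'.mul_right (‖x‖ ^ 2)
    rw [one_mul] at h3
    refine hasSum_le (fun k => ?_) h1 h3
    rw [← mul_pow]
    gcongr
    exact norm_inner_le_norm _ _
  refine (ContinuousLinearMap.isPositive_iff_complex _).2 fun x => ?_
  have : ⟪(1 - S * S) x, x⟫_ℂ = ((‖x‖ ^ 2 - ‖S x‖ ^ 2 : ℝ) : ℂ) := by
    rw [sub_apply, inner_sub_left, ← inner_conj_symm ((S * S) x), key,
      one_apply_eq_self, inner_self_eq_norm_sq_to_K]
    simp
  rw [this, RCLike.re_to_complex, Complex.ofReal_re]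
  exact ⟨rfl, sub_nonneg.2 (hle x)⟩

theorem ContinuousLinearMap.IsPositive.norm_le_one {T : H →L[ℂ] H} (hT : T.IsPositive)
    (hT' : (1 - T).IsPositive) : ‖T‖ ≤ 1 :=
  (CStarAlgebra.norm_le_one_iff_of_nonneg T
    ((ContinuousLinearMap.nonneg_iff_isPositive _).2 hT)).2 ((ContinuousLinearMap.le_def _ _).2 hT')

theorem isPositive_sum {ι : Type*} (s : Finset ι) {T : ι → H →L[ℂ] H}
    (hT : ∀ i ∈ s, (T i).IsPositive) : (∑ i ∈ s, T i).IsPositive := by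
  rw [← ContinuousLinearMap.nonneg_iff_isPositive]
  exact Finset.sum_nonneg fun i hi => (ContinuousLinearMap.nonneg_iff_isPositive _).2 (hT i hi)

/-- The closed unit ball of bounded operators is compact in the weak operator topology. -/
theorem exists_wot_limit {ι : Type*} (U : Ultrafilter ι) (A : ι → H →L[ℂ] H)
    (hA : ∀ i, ‖A i‖ ≤ 1) :
    ∃ Ω : H →L[ℂ] H, ∀ ξ η, Tendsto (fun i => ⟪ξ, A i η⟫_ℂ) U (𝓝 ⟪ξ, Ω η⟫_ℂ) := by
  have hbd : ∀ i ξ η, ‖⟪A i ξ, η⟫_ℂ‖ ≤ 1 * ‖ξ‖ * ‖η‖ := fun i ξ η =>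
    (norm_inner_le_norm _ _).trans <| by
      gcongr
      exact (A i).le_of_opNorm_le (hA i) ξ
  have hex : ∀ ξ η, ∃ L : ℂ, ‖L‖ ≤ 1 * ‖ξ‖ * ‖η‖ ∧
      Tendsto (fun i => ⟪A i ξ, η⟫_ℂ) U (𝓝 L) := fun ξ η => by
    obtain ⟨L, hL, hlim⟩ := (isCompact_closedBall (0 : ℂ) (1 * ‖ξ‖ * ‖η‖)).ultrafilter_le_nhds'
      (U.map fun i => ⟪A i ξ, η⟫_ℂ)
      (Ultrafilter.mem_map.2 (Filter.univ_mem' fun i => by simpa using hbd i ξ η))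
    exact ⟨L, by simpa using hL, hlim⟩
  choose L hL hlim using hex
  let B : H →ₗ⋆[ℂ] H →ₗ[ℂ] ℂ := LinearMap.mk₂'ₛₗ (starRingEnd ℂ) (RingHom.id ℂ) L
    (fun x y z => tendsto_nhds_unique (hlim _ _)
      (by simpa [inner_add_left] using (hlim x z).add (hlim y z)))
    (fun c x z => tendsto_nhds_unique (hlim _ _)
      (by simpa [inner_smul_left, mul_comm] using (hlim x z).const_mul (starRingEnd ℂ c)))
    (fun x y z => tendsto_nhds_unique (hlim _ _)
      (by simpa [inner_add_right] using (hlim x y).add (hlim x z)))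
    (fun c x z => tendsto_nhds_unique (hlim _ _)
      (by simpa [inner_smul_right] using (hlim x z).const_mul c))
  refine ⟨InnerProductSpace.continuousLinearMapOfBilin (B.mkContinuous₂ 1 hL), fun ξ η => ?_⟩
  rw [← inner_conj_symm]
  simp only [← inner_conj_symm ξ]
  refine (Complex.continuous_conj.tendsto _).comp ?_
  rw [InnerProductSpace.continuousLinearMapOfBilin_apply]
  exact hlim η ξ

theorem ContinuousLinearMap.isPositive_of_tendsto {H : Type*} [NormedAddCommGroup H]
    [InnerProductSpace ℂ H] {ι : Type*} {l : Filter ι} [l.NeBot]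
    {A : ι → H →L[ℂ] H} {Ω : H →L[ℂ] H} (hA : ∀ i, (A i).IsPositive)
    (hlim : ∀ ξ, Tendsto (fun i => ⟪ξ, A i ξ⟫_ℂ) l (𝓝 ⟪ξ, Ω ξ⟫_ℂ)) : Ω.IsPositive := by
  have h0 : ∀ ξ, 0 ≤ ⟪ξ, Ω ξ⟫_ℂ := fun ξ =>
    ge_of_tendsto' (hlim ξ) fun i => (hA i).inner_nonneg_right ξ
  refine (ContinuousLinearMap.isPositive_iff_complex _).2 fun ξ => ?_
  have h := Complex.nonneg_iff.1 (h0 ξ)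
  have : ⟪Ω ξ, ξ⟫_ℂ = ⟪ξ, Ω ξ⟫_ℂ := by
    rw [← inner_conj_symm, Complex.conj_eq_iff_im]
    exact h.2.symm
  rw [this]
  exact ⟨Complex.ext (by simp) (by simpa using h.2), h.1⟩

end Positive

section HilbertTensor

variable {HA HB H : Type*}
  [NormedAddCommGroup HA] [InnerProductSpace ℂ HA]
  [NormedAddCommGroup HB] [InnerProductSpace ℂ HB]
  [NormedAddCommGroup H] [InnerProductSpace ℂ H]
  {t : HB →ₗ[ℂ] HA →ₗ[ℂ] H}

open scoped TensorProduct

theorem ext_of_eq_on_tensors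
    (hdense : (Submodule.span ℂ
        (Set.range fun p : HB × HA => t p.1 p.2)).topologicalClosure = ⊤)
    {P Q : H →L[ℂ] H} (h : ∀ x y, P (t x y) = Q (t x y)) : P = Q := by
  refine ContinuousLinearMap.ext_on (Submodule.dense_iff_topologicalClosure_eq_top.2 hdense) ?_
  rintro _ ⟨p, rfl⟩
  exact h p.1 p.2

theorem eq_of_inner_tensors_eq
    (hdense : (Submodule.span ℂ
        (Set.range fun p : HB × HA => t p.1 p.2)).topologicalClosure = ⊤)
    {u v : H} (h : ∀ x y, ⟪t x y, u⟫_ℂ = ⟪t x y, v⟫_ℂ) : u = v := by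
  have : innerSL ℂ u = innerSL ℂ v := by
    refine ContinuousLinearMap.ext_on (Submodule.dense_iff_topologicalClosure_eq_top.2 hdense) ?_
    rintro _ ⟨p, rfl⟩
    simp only [innerSL_apply_apply]
    rw [← inner_conj_symm, h, inner_conj_symm]
  exact innerSL_inj.1 this

/-- The isometry from the algebraic tensor product into a model of the Hilbert tensor product. -/
noncomputable def tensorIsometry (t : HB →ₗ[ℂ] HA →ₗ[ℂ] H)
    (hinner : ∀ (x x' : HB) (y y' : HA),
      ⟪t x y, t x' y'⟫_ℂ = ⟪x, x'⟫_ℂ * ⟪y, y'⟫_ℂ) : HB ⊗[ℂ] HA →ₗᵢ[ℂ] H :=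
  (TensorProduct.lift t).isometryOfInner fun u v => by
    induction u with
    | zero => simp
    | add u u' hu hu' => simp [inner_add_left, hu, hu']
    | tmul x y =>
      induction v with
      | zero => simp
      | add v v' hv hv' => rw [map_add, inner_add_right, inner_add_right, hv, hv']
      | tmul x' y' => simp [hinner]

theorem tensorIsometry_tmul
    (hinner : ∀ (x x' : HB) (y y' : HA),
      ⟪t x y, t x' y'⟫_ℂ = ⟪x, x'⟫_ℂ * ⟪y, y'⟫_ℂ) (x : HB) (y : HA) :
    tensorIsometry t hinner (x ⊗ₜ y) = t x y := by
  simp [tensorIsometry]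

theorem denseRange_tensorIsometry
    (hinner : ∀ (x x' : HB) (y y' : HA),
      ⟪t x y, t x' y'⟫_ℂ = ⟪x, x'⟫_ℂ * ⟪y, y'⟫_ℂ)
    (hdense : (Submodule.span ℂ
        (Set.range fun p : HB × HA => t p.1 p.2)).topologicalClosure = ⊤) :
    DenseRange (tensorIsometry t hinner) := by
  refine (Submodule.dense_iff_topologicalClosure_eq_top.2 hdense).mono ?_
  change _ ⊆ ((LinearMap.range (tensorIsometry t hinner).toLinearMap : Submodule ℂ H) : Set H)
  rw [SetLike.coe_subset_coe, Submodule.span_le]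
  rintro _ ⟨p, rfl⟩
  exact ⟨p.1 ⊗ₜ p.2, tensorIsometry_tmul hinner _ _⟩

theorem exists_tensorOp [CompleteSpace H]
    (hinner : ∀ (x x' : HB) (y y' : HA),
      ⟪t x y, t x' y'⟫_ℂ = ⟪x, x'⟫_ℂ * ⟪y, y'⟫_ℂ)
    (hdense : (Submodule.span ℂ
        (Set.range fun p : HB × HA => t p.1 p.2)).topologicalClosure = ⊤)
    (a : HB →L[ℂ] HB) (b : HA →L[ℂ] HA) :
    ∃ R : H →L[ℂ] H, ∀ x y, R (t x y) = t (a x) (b y) := by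
  let T := tensorIsometry t hinner
  refine ⟨(T.toContinuousLinearMap ∘L TensorProduct.mapL a b).extend T.toContinuousLinearMap,
    fun x y => ?_⟩
  have := (T.toContinuousLinearMap ∘L TensorProduct.mapL a b).extend_eq
    (e := T.toContinuousLinearMap) (denseRange_tensorIsometry hinner hdense)
    T.isometry.isUniformInducing (x ⊗ₜ y)
  simpa [T, tensorIsometry_tmul] using this

variable [CompleteSpace HA] [CompleteSpace HB] [CompleteSpace H]

theorem exists_tensorOp_isPositive
    (hinner : ∀ (x x' : HB) (y y' : HA),
      ⟪t x y, t x' y'⟫_ℂ = ⟪x, x'⟫_ℂ * ⟪y, y'⟫_ℂ)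
    (hdense : (Submodule.span ℂ
        (Set.range fun p : HB × HA => t p.1 p.2)).topologicalClosure = ⊤)
    {a : HB →L[ℂ] HB} {b : HA →L[ℂ] HA} (ha : a.IsPositive) (hb : b.IsPositive) :
    ∃ R : H →L[ℂ] H, R.IsPositive ∧ ∀ x y, R (t x y) = t (a x) (b y) := by
  obtain ⟨sa, hsa, rfl⟩ := ha.exists_sqrt
  obtain ⟨sb, hsb, rfl⟩ := hb.exists_sqrt
  obtain ⟨S, hS⟩ := exists_tensorOp hinner hdense sa sb
  refine ⟨star S * S, (ContinuousLinearMap.nonneg_iff_isPositive _).1 (star_mul_self_nonneg S),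
    fun x y => eq_of_inner_tensors_eq hdense fun x' y' => ?_⟩
  rw [mul_apply_eq_comp, ContinuousLinearMap.star_eq_adjoint,
    ContinuousLinearMap.adjoint_inner_right, hS, hS, hinner, hinner,
    hsa.inner_left_eq_inner_right, hsb.inner_left_eq_inner_right]
  rfl

/-- A finite sum `∑ ρ_α ⊗ M_α`, with `0 ≤ ρ_α ≤ 1` and `{M_α}` a resolution of the identity,
is a positive contraction. -/
theorem exists_sum_tensorOp
    (hinner : ∀ (x x' : HB) (y y' : HA),
      ⟪t x y, t x' y'⟫_ℂ = ⟪x, x'⟫_ℂ * ⟪y, y'⟫_ℂ)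
    (hdense : (Submodule.span ℂ
        (Set.range fun p : HB × HA => t p.1 p.2)).topologicalClosure = ⊤)
    {ι : Type*} [Fintype ι] {a : ι → HB →L[ℂ] HB} {b : ι → HA →L[ℂ] HA}
    (ha : ∀ i, (a i).IsPositive) (ha' : ∀ i, (1 - a i).IsPositive)
    (hb : ∀ i, (b i).IsPositive) (hb' : ∑ i, b i = 1) :
    ∃ A : H →L[ℂ] H, A.IsPositive ∧ ‖A‖ ≤ 1 ∧
      ∀ x y, A (t x y) = ∑ i, t (a i x) (b i y) := by
  choose R hR hRt using fun i => exists_tensorOp_isPositive hinner hdense (ha i) (hb i)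
  choose R' hR' hRt' using fun i => exists_tensorOp_isPositive hinner hdense (ha' i) (hb i)
  have hpos : (∑ i, R i).IsPositive := isPositive_sum _ fun i _ => hR i
  refine ⟨∑ i, R i, hpos, hpos.norm_le_one ?_, fun x y => by simp [sum_apply, hRt]⟩
  have : 1 - ∑ i, R i = ∑ i, R' i := by
    rw [sub_eq_iff_eq_add]
    refine ext_of_eq_on_tensors hdense fun x y => ?_
    have h1 : ∑ i, b i y = y := by simpa using congrArg (fun T : HA →L[ℂ] HA => T y) hb'
    simp only [add_apply, sum_apply, hRt, hRt',
      ← Finset.sum_add_distrib, ← LinearMap.add_apply, ← map_add, sub_apply,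
      one_apply_eq_self, sub_add_cancel]
    rw [← map_sum, h1]
  rw [this]
  exact isPositive_sum _ fun i _ => hR' i

end HilbertTensor

section Approximation

open MeasureTheory

/-- Finitely many integrals of bounded measurable functions against finite measures are
simultaneously approximated by Riemann sums over one finite measurable partition. -/
theorem exists_partition_integral_approx {X P V : Type*} [MeasurableSpace X] [Finite P] [Finite V]
    (f : P → X → ℂ) (hf : ∀ p, Measurable (f p)) {C : P → ℝ} (hC : ∀ p x, ‖f p x‖ ≤ C p)
    (ν : V → Measure X) [∀ v, IsFiniteMeasure (ν v)] {ε : ℝ} (hε : 0 < ε) :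
    ∃ (m : ℕ) (E : Fin m → Set X) (x : Fin m → X),
      (∀ α, MeasurableSet (E α)) ∧ Pairwise (Function.onFun Disjoint E) ∧
      ⋃ α, E α = Set.univ ∧
      ∀ p v, ‖∫ z, f p z ∂(ν v) - ∑ α, f p (x α) * (ν v).real (E α)‖ < ε := by
  cases nonempty_fintype P
  rcases isEmpty_or_nonempty X with hX | ⟨⟨x₀⟩⟩
  · refine ⟨0, Fin.elim0, Fin.elim0, fun α => α.elim0, fun α => α.elim0,
      Set.eq_univ_of_forall fun x => hX.elim x, fun p v => ?_⟩
    simpa [Measure.eq_zero_of_isEmpty] using hε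
  let F : X → P → ℂ := fun z p => f p z
  have hF : Measurable F := measurable_pi_lambda _ hf
  have hFint : ∀ v, Integrable F (ν v) := fun v =>
    Integrable.of_eval fun p => Integrable.of_bound (hf p).aestronglyMeasurable (C p)
      (Filter.Eventually.of_forall (hC p))
  have h₀ : F x₀ ∈ Set.range F := ⟨x₀, rfl⟩
  have hlim : ∀ v, Tendsto (fun n => (SimpleFunc.approxOn F hF (Set.range F) (F x₀) h₀ n).integral
      (ν v)) atTop (𝓝 (∫ z, F z ∂(ν v))) := fun v =>
    tendsto_integral_approxOn_of_measurable (hFint v) hF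
      (Filter.Eventually.of_forall fun z => subset_closure (Set.mem_range_self z)) h₀ (integrable_const _)
  obtain ⟨n, hn⟩ := (Filter.eventually_all.2 fun v =>
    (Metric.tendsto_nhds.1 (hlim v) ε hε)).exists
  let s := SimpleFunc.approxOn F hF (Set.range F) (F x₀) h₀ n
  have hs : ∀ y : s.range, ∃ x, F x = y := fun y => by
    obtain ⟨z, hz⟩ := SimpleFunc.mem_range.1 y.2
    rw [← hz]
    exact SimpleFunc.approxOn_mem hF h₀ n z
  choose x hx using hs
  let φ := s.range.equivFin
  refine ⟨s.range.card, fun α => s ⁻¹' {(φ.symm α : P → ℂ)}, fun α => x (φ.symm α),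
    fun α => s.measurableSet_fiber _, fun α β hαβ => ?_, Set.eq_univ_of_forall fun z => ?_,
    fun p v => ?_⟩
  · refine Disjoint.preimage _ (Set.disjoint_singleton.2 fun h => hαβ ?_)
    exact φ.symm.injective (Subtype.ext h)
  · exact Set.mem_iUnion.2 ⟨φ ⟨s z, s.mem_range_self z⟩, by simp⟩
  · have h1 := hn v
    rw [dist_comm, dist_eq_norm] at h1
    have h2 := (norm_le_pi_norm _ p).trans_lt h1
    have hsum : s.integral (ν v) p =
        ∑ α, f p (x (φ.symm α)) * (ν v).real (s ⁻¹' {(φ.symm α : P → ℂ)}) := by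
      rw [SimpleFunc.integral_eq_sum_of_subset (Finset.filter_subset _ _),
        Finset.sum_apply, ← Finset.sum_coe_sort, ← φ.symm.sum_comp]
      refine Finset.sum_congr rfl fun α _ => ?_
      have : f p (x (φ.symm α)) = (φ.symm α : P → ℂ) p := congrFun (hx (φ.symm α)) p
      rw [this, mul_comm]
      rfl
    rwa [Pi.sub_apply, eval_integral fun p => (hFint v).eval p, hsum] at h2

end Approximation

theorem sesquilinear_eq_zero_of_diag_eq_zero {V : Type*} [AddCommGroup V] [Module ℂ V]
    (D : V → V → ℂ) (hadd : ∀ x y z, D (x + y) z = D x z + D y z)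
    (hadd' : ∀ x y z, D x (y + z) = D x y + D x z)
    (hsmul : ∀ (c : ℂ) x y, D (c • x) y = starRingEnd ℂ c * D x y)
    (hsmul' : ∀ (c : ℂ) x y, D x (c • y) = c * D x y)
    (hdiag : ∀ x, D x x = 0) (x y : V) : D x y = 0 := by
  have h1 := hdiag (x + y)
  have h2 := hdiag (x + Complex.I • y)
  simp only [hadd, hadd', hsmul, hsmul', hdiag, Complex.conj_I] at h1 h2
  linear_combination h1 / 2 - Complex.I * h2 / 2 + (D x y - D y x) / 2 * Complex.I_sq

/-- Let `Φ(ρ) = ∫_X ρ_B(x) μ_ρ(dx)`, `μ_ρ(E) = Tr ρ M_A(E)`, be an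
entanglement-breaking channel given by a POVM `M_A` on a complete separable metric
space `X` and a Borel family of states `ρ_B(x)`.  Then the Choi–Jamiolkowski form of
`Φ` is given by a bounded positive operator `Ω_Φ` on the Hilbert tensor product
`H_B ⊗ H_A` (modelled by `H`, `t`) which is separable (lies in the WOT closure of the
convex set of operators `∑_α ρ_α ⊗ M_α`) and satisfies `‖Ω_Φ‖ ≤ 1`. -/
theorem entanglement_breaking_cj_operator
    {HA HB H : Type*}
    [NormedAddCommGroup HA] [InnerProductSpace ℂ HA] [CompleteSpace HA]
    [NormedAddCommGroup HB] [InnerProductSpace ℂ HB] [CompleteSpace HB]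
    [NormedAddCommGroup H] [InnerProductSpace ℂ H] [CompleteSpace H]
    -- the Hilbert tensor product H = H_B ⊗ H_A
    (t : HB →ₗ[ℂ] HA →ₗ[ℂ] H)
    (hinner : ∀ (x x' : HB) (y y' : HA),
      ⟪t x y, t x' y'⟫_ℂ = ⟪x, x'⟫_ℂ * ⟪y, y'⟫_ℂ)
    (hdense : (Submodule.span ℂ
        (Set.range fun p : HB × HA => t p.1 p.2)).topologicalClosure = ⊤)
    (e : HilbertBasis ℕ ℂ HA) (g : HilbertBasis ℕ ℂ HB)
    -- X : complete separable metric space with Borel structure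
    {X : Type*} [MetricSpace X] [CompleteSpace X] [TopologicalSpace.SeparableSpace X]
    [MeasurableSpace X] [BorelSpace X]
    -- the POVM M_A on X in H_A
    (M : Set X → (HA →L[ℂ] HA))
    (hMpos : ∀ E : Set X, MeasurableSet E → (M E).IsPositive)
    (hMadd : ∀ (ψ ψ' : HA) (E : ℕ → Set X), (∀ n, MeasurableSet (E n)) →
      Pairwise (Function.onFun Disjoint E) →
      HasSum (fun n => ⟪ψ, M (E n) ψ'⟫_ℂ) ⟪ψ, M (⋃ n, E n) ψ'⟫_ℂ)
    (hMone : M Set.univ = 1)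
    -- the Borel family of states ρ_B(x)
    (ρB : X → (HB →L[ℂ] HB))
    (hρpos : ∀ x, (ρB x).IsPositive)
    (hρtr : ∀ x, HasSum (fun k => ⟪g k, (ρB x) (g k)⟫_ℂ) 1)
    (hρmeas : ∀ (φ φ' : HB), Measurable fun x => ⟪φ, (ρB x) φ'⟫_ℂ)
    -- the measures μ_ρ(E) = Tr ρ M_A(E) for ρ = |ψ⟩⟨ψ|
    (ν : HA → MeasureTheory.Measure X)
    (hνfin : ∀ ψ, MeasureTheory.IsFiniteMeasure (ν ψ))
    (hν : ∀ (ψ : HA) (E : Set X), MeasurableSet E →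
      ν ψ E = ENNReal.ofReal (⟪ψ, M E ψ⟫_ℂ).re)
    -- the channel Φ(ρ) = ∫ ρ_B(x) μ_ρ(dx)
    (Φ : (HA →L[ℂ] HA) →ₗ[ℂ] (HB →L[ℂ] HB))
    (hΦ : ∀ (ψ : HA) (φ φ' : HB),
      ⟪φ, Φ (rankOne ψ ψ) φ'⟫_ℂ = ∫ x, ⟪φ, (ρB x) φ'⟫_ℂ ∂(ν ψ)) :
    ∃ Ω : H →L[ℂ] H,
      Ω.IsPositive ∧ ‖Ω‖ ≤ 1 ∧
      -- Ω is the Choi–Jamiolkowski operator of Φ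
      (∀ (ψB ψB' : HB) (ψA ψA' : HA),
        ⟪t ψB ψA, Ω (t ψB' ψA')⟫_ℂ
          = ⟪ψB, Φ (rankOne (conjVec e ψA) (conjVec e ψA')) ψB'⟫_ℂ) ∧
      -- Ω is separable : WOT-limit of operators ∑_α ρ_α ⊗ M_α
      (∀ (ε : ℝ), 0 < ε → ∀ (n : ℕ) (ξ η : Fin n → H),
        ∃ A : H →L[ℂ] H, (∃ (m : ℕ)
          (Mf : Fin m → (HA →L[ℂ] HA)) (ρf : Fin m → (HB →L[ℂ] HB)),
          (∀ α, (Mf α).IsPositive) ∧ (∑ α, Mf α = 1) ∧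
          (∀ α, (ρf α).IsPositive) ∧
          (∀ α, HasSum (fun k => ⟪g k, (ρf α) (g k)⟫_ℂ) 1) ∧
          (∀ (x : HB) (y : HA), A (t x y) = ∑ α, t ((ρf α) x) ((Mf α) y))) ∧
          ∀ i, ‖⟪ξ i, Ω (η i)⟫_ℂ - ⟪ξ i, A (η i)⟫_ℂ‖ < ε) := by
  classical
  have hρ1 : ∀ x, (1 - ρB x).IsPositive := fun x =>
    isPositive_one_sub_of_hasSum_trace g (hρpos x) (hρtr x)
  have hbound : ∀ (φ φ' : HB) x, ‖⟪φ, (ρB x) φ'⟫_ℂ‖ ≤ ‖φ‖ * ‖φ'‖ := fun φ φ' x =>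
    (norm_inner_le_norm _ _).trans <| by
      gcongr
      simpa using (ρB x).le_of_opNorm_le ((hρpos x).norm_le_one (hρ1 x)) φ'
  have hνreal : ∀ ψ E, MeasurableSet E → ⟪ψ, M E ψ⟫_ℂ = (ν ψ).real E := fun ψ E hE => by
    have h := Complex.nonneg_iff.1 ((hMpos E hE).inner_nonneg_right ψ)
    rw [MeasureTheory.measureReal_def, hν ψ E hE, ENNReal.toReal_ofReal h.1]
    exact Complex.ext (by simp) (by simpa using h.2.symm)
  have approx : ∀ (S : Finset (HB × HB × HA)) (ε : ℝ), 0 < ε → ∃ A : H →L[ℂ] H,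
      A.IsPositive ∧ ‖A‖ ≤ 1 ∧
      (∃ (m : ℕ) (Mf : Fin m → (HA →L[ℂ] HA)) (ρf : Fin m → (HB →L[ℂ] HB)),
          (∀ α, (Mf α).IsPositive) ∧ (∑ α, Mf α = 1) ∧
          (∀ α, (ρf α).IsPositive) ∧
          (∀ α, HasSum (fun k => ⟪g k, (ρf α) (g k)⟫_ℂ) 1) ∧
          (∀ (x : HB) (y : HA), A (t x y) = ∑ α, t ((ρf α) x) ((Mf α) y))) ∧
      ∀ q ∈ S, ‖⟪q.1, Φ (rankOne q.2.2 q.2.2) q.2.1⟫_ℂ -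
        ⟪t q.1 (conjVec e q.2.2), A (t q.2.1 (conjVec e q.2.2))⟫_ℂ‖ < ε := by
    intro S ε hε
    obtain ⟨m, E, x, hE, hdisj, huniv, happ⟩ := exists_partition_integral_approx
      (fun (q : S) x => ⟪q.1.1, (ρB x) q.1.2.1⟫_ℂ) (fun q => hρmeas _ _)
      (fun q x => hbound _ _ x) (fun q : S => ν q.1.2.2) hε
    have hsum : ∑ α, conjOp e (M (E α)) = 1 := by
      rw [← ContinuousLinearMap.coe_inj, ← ext_inner_map]
      intro ψ
      have h1 : ∑ α, (ν (conjVec e ψ)).real (E α) = (ν (conjVec e ψ)).real Set.univ := by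
        rw [← huniv, MeasureTheory.measureReal_iUnion_fintype hdisj hE]
      have h2 := hνreal (conjVec e ψ) Set.univ MeasurableSet.univ
      rw [hMone, one_apply_eq_self, inner_conjVec_conjVec, ← h1] at h2
      simp only [ContinuousLinearMap.coe_coe, sum_apply, one_apply_eq_self, sum_inner,
        inner_conjOp, hνreal _ _ (hE _), h2]
      push_cast
      rfl
    obtain ⟨A, hApos, hAnorm, hA⟩ := exists_sum_tensorOp hinner hdense
      (fun α => hρpos (x α)) (fun α => hρ1 (x α))
      (fun α => (hMpos _ (hE α)).conjOp e) hsum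
    refine ⟨A, hApos, hAnorm, ⟨m, _, _, fun α => (hMpos _ (hE α)).conjOp e, hsum,
      fun α => hρpos (x α), fun α => hρtr (x α), hA⟩, fun q hq => ?_⟩
    have h := happ ⟨q, hq⟩ ⟨q, hq⟩
    rw [← hΦ] at h
    simp only [hA, inner_sum, hinner]
    convert h using 6 with α
    rw [← hνreal _ _ (hE α), conjOp_apply, conjVec_conjVec, inner_conjVec_conjVec,
      (hMpos _ (hE α)).inner_left_eq_inner_right]
  choose A hApos hAnorm hAsep hAapp using fun i : Finset (HB × HB × HA) × ℕ =>
    approx i.1 (1 / ((i.2 : ℝ) + 1)) Nat.one_div_pos_of_nat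
  let U : Ultrafilter (Finset (HB × HB × HA) × ℕ) := Ultrafilter.of atTop
  obtain ⟨Ω, hΩ⟩ := exists_wot_limit U A hAnorm
  have hΩpos : Ω.IsPositive :=
    ContinuousLinearMap.isPositive_of_tendsto hApos fun ξ => hΩ ξ ξ
  have hΩone : (1 - Ω).IsPositive := by
    refine ContinuousLinearMap.isPositive_of_tendsto (l := (U : Filter _))
      (A := fun i => 1 - A i) (fun i => ?_) fun ξ => ?_
    · exact (ContinuousLinearMap.le_def _ _).1 ((CStarAlgebra.norm_le_one_iff_of_nonneg (A i)
        ((ContinuousLinearMap.nonneg_iff_isPositive _).2 (hApos i))).1 (hAnorm i))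
    · simpa [inner_sub_right] using (hΩ ξ ξ).const_sub ⟪ξ, ξ⟫_ℂ
  have hdiag : ∀ (φ φ' : HB) (ψ : HA),
      ⟪t φ ψ, Ω (t φ' ψ)⟫_ℂ = ⟪φ, Φ (rankOne (conjVec e ψ) (conjVec e ψ)) φ'⟫_ℂ := by
    intro φ φ' ψ
    refine tendsto_nhds_unique (hΩ _ _) ?_
    rw [tendsto_iff_norm_sub_tendsto_zero]
    have hlim : Tendsto (fun i : Finset (HB × HB × HA) × ℕ => 1 / ((i.2 : ℝ) + 1)) U (𝓝 0) := by
      refine (tendsto_one_div_add_atTop_nhds_zero_nat.comp ?_).mono_left (Ultrafilter.of_le atTop)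
      rw [← prod_atTop_atTop_eq]
      exact tendsto_snd
    refine squeeze_zero' (Eventually.of_forall fun _ => norm_nonneg _) ?_ hlim
    refine Ultrafilter.of_le atTop ?_
    filter_upwards [eventually_ge_atTop (({(φ, φ', conjVec e ψ)}, 0) :
      Finset (HB × HB × HA) × ℕ)] with i hi
    have h := hAapp i (φ, φ', conjVec e ψ) (hi.1 (Finset.mem_singleton_self _))
    rw [conjVec_conjVec, norm_sub_rev] at h
    exact h.le
  refine ⟨Ω, hΩpos, hΩpos.norm_le_one hΩone, fun φ φ' ψ ψ' => ?_, fun ε hε n ξ η => ?_⟩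
  · rw [← sub_eq_zero]
    have rankOne_add_left : ∀ a b c : HA, rankOne (a + b) c = rankOne a c + rankOne b c :=
      fun a b c => by ext; simp [rankOne]
    have rankOne_add_right : ∀ a b c : HA, rankOne a (b + c) = rankOne a b + rankOne a c :=
      fun a b c => by ext; simp [rankOne, add_smul]
    have rankOne_smul_left : ∀ (c : ℂ) (a b : HA), rankOne (c • a) b = c • rankOne a b :=
      fun c a b => by ext; simp [rankOne, smul_smul, mul_comm]
    have rankOne_smul_right : ∀ (c : ℂ) (a b : HA),
        rankOne a (c • b) = starRingEnd ℂ c • rankOne a b :=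
      fun c a b => by ext; simp [rankOne, smul_smul, mul_comm]
    refine sesquilinear_eq_zero_of_diag_eq_zero (fun ψ ψ' => ⟪t φ ψ, Ω (t φ' ψ')⟫_ℂ -
      ⟪φ, Φ (rankOne (conjVec e ψ) (conjVec e ψ')) φ'⟫_ℂ) (fun a b c => ?_) (fun a b c => ?_)
      (fun c a b => ?_) (fun c a b => ?_) (fun a => sub_eq_zero.2 (hdiag φ φ' a)) ψ ψ'
    · simp only [map_add, conjVec_add, rankOne_add_left, inner_add_left, add_apply,
        inner_add_right]
      ring
    · simp only [map_add, conjVec_add, rankOne_add_right, add_apply, inner_add_right]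
      ring
    · simp only [map_smul, conjVec_smul, rankOne_smul_left, inner_smul_left, smul_apply,
        inner_smul_right]
      ring
    · simp only [map_smul, conjVec_smul, rankOne_smul_right, smul_apply, inner_smul_right,
        Complex.conj_conj]
      ring
  · obtain ⟨i, hi⟩ := (Filter.eventually_all.2 fun k =>
      Metric.tendsto_nhds.1 (hΩ (ξ k) (η k)) ε hε).exists
    refine ⟨A i, hAsep i, fun k => ?_⟩
    rw [← dist_eq_norm, dist_comm]
    exact hi k
end

section
/- Let μ be a real symmetric 2s×2s matrix and Δ_K a real skew-symmetric 2s×2s matrix such that the Hermitian matrix μ - (i/2)Δ_K is positive semidefinite. Then there exists an invertible real matrix T such that T^t μ T = diag(μ̃, I/2, 0) and T^t Δ_K T = diag(Δ, 0, 0), where in the first block (of size rank Δ_K) Δ is the direct sum of 2×2 standard symplectic blocks [[0,-1],[1,0]] and μ̃ = diag of 2×2 blocks μ_j I_2 with μ_j ≥ 1/2, the second block has size rank μ − rank Δ_K, and the third block has size 2s − rank μ. -/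
open Matrix
open scoped ComplexOrder
open Module (finrank)

theorem exists_orthonormal_pair_of_skew {E : Type*} [NormedAddCommGroup E]
    [InnerProductSpace ℝ E] [FiniteDimensional ℝ E] (A : E →ₗ[ℝ] E)
    (hA : ∀ x y, inner ℝ (A x) y = -inner ℝ x (A y)) (h0 : A ≠ 0) :
    ∃ (x y : E) (a : ℝ), 0 < a ∧ inner ℝ x x = (1 : ℝ) ∧ inner ℝ y y = (1 : ℝ) ∧
      inner ℝ x y = (0 : ℝ) ∧ A x = a • y ∧ A y = -(a • x) := by
  have hS : (A ∘ₗ A).IsSymmetric := fun x y => by simp [hA]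
  obtain ⟨i, hi⟩ : ∃ i, A (hS.eigenvectorBasis rfl i) ≠ 0 := by
    by_contra! h
    exact h0 ((hS.eigenvectorBasis rfl).toBasis.ext fun i => by simpa using h i)
  have hx : inner ℝ (hS.eigenvectorBasis rfl i) (hS.eigenvectorBasis rfl i) = (1 : ℝ) := by simp
  have he := hS.apply_eigenvectorBasis rfl i
  generalize hS.eigenvectorBasis rfl i = x at *
  generalize hS.eigenvalues rfl i = l at *
  simp only [LinearMap.comp_apply, RCLike.ofReal_real_eq_id, id_eq] at he
  have hn : 0 < ‖A x‖ := norm_pos_iff.2 hi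
  have hxx : inner ℝ (A x) (A x) = -l := by rw [hA, he, inner_smul_right, hx, mul_one]
  have hl : l = -(‖A x‖ * ‖A x‖) := by
    rw [← real_inner_self_eq_norm_mul_norm, hxx, neg_neg]
  have hxy : inner ℝ x (A x) = (0 : ℝ) := by
    have := hA x x
    rw [real_inner_comm] at this
    linarith
  refine ⟨x, ‖A x‖⁻¹ • A x, ‖A x‖, hn, hx, ?_, ?_, ?_, ?_⟩
  · rw [inner_smul_left, inner_smul_right, hxx, hl]
    simp
    field_simp
  · rw [inner_smul_right, hxy, mul_zero]
  · rw [smul_smul, mul_inv_cancel₀ hn.ne', one_smul]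
  · rw [map_smul, he, smul_smul, hl, ← neg_smul]
    congr 1
    field_simp

theorem exists_orthonormal_pairs_of_skew (n : ℕ) :
    ∀ {E : Type*} [NormedAddCommGroup E] [InnerProductSpace ℝ E] [FiniteDimensional ℝ E]
    (A : E →ₗ[ℝ] E) (_ : ∀ x y, inner ℝ (A x) y = -inner ℝ x (A y)) (_ : finrank ℝ E = n),
    ∃ (d : ℕ) (x y : Fin d → E) (a : Fin d → ℝ), (∀ i, 0 < a i) ∧
      (∀ i j, inner ℝ (x i) (x j) = if i = j then (1 : ℝ) else 0) ∧
      (∀ i j, inner ℝ (y i) (y j) = if i = j then (1 : ℝ) else 0) ∧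
      (∀ i j, inner ℝ (x i) (y j) = (0 : ℝ)) ∧
      (∀ i, A (x i) = a i • y i) ∧ (∀ i, A (y i) = -(a i • x i)) ∧
      ∀ w, (∀ i, inner ℝ (x i) w = (0 : ℝ)) → (∀ i, inner ℝ (y i) w = (0 : ℝ)) → A w = 0 := by
  induction n using Nat.strong_induction_on with
  | _ n ih =>
  intro E _ _ _ A hA hn
  by_cases h0 : A = 0
  · exact ⟨0, Fin.elim0, Fin.elim0, Fin.elim0, by simp [h0]⟩
  obtain ⟨x, y, a, ha, hx, hy, hxy, hAx, hAy⟩ := exists_orthonormal_pair_of_skew A hA h0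
  let W : Submodule ℝ E := (Submodule.span ℝ {x, y})ᗮ
  have hW : ∀ w, w ∈ W ↔ inner ℝ x w = (0 : ℝ) ∧ inner ℝ y w = (0 : ℝ) := by
    intro w
    rw [Submodule.mem_orthogonal]
    constructor
    · exact fun h => ⟨h x (Submodule.subset_span (by simp)), h y (Submodule.subset_span (by simp))⟩
    · rintro ⟨h1, h2⟩ u hu
      obtain ⟨p, q, rfl⟩ := Submodule.mem_span_pair.1 hu
      simp [inner_add_left, inner_smul_left, h1, h2]
  have hAW : ∀ w ∈ W, A w ∈ W := by
    intro w hw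
    rw [hW] at hw ⊢
    have h1 := hA x w
    have h2 := hA y w
    rw [hAx, inner_smul_left, hw.2] at h1
    rw [hAy, inner_neg_left, inner_smul_left, hw.1] at h2
    simp at h1 h2
    exact ⟨h1, h2⟩
  have hlt : finrank ℝ W < n := by
    rw [← hn]
    refine Submodule.finrank_lt fun h => ?_
    have := ((hW x).1 (h ▸ Submodule.mem_top)).1
    linarith
  obtain ⟨d, x', y', a', ha', hx', hy', hxy', hAx', hAy', hw'⟩ :=
    ih _ hlt (A.restrict hAW) (fun u v => hA u v) rfl
  have mx := fun i => (hW _).1 (x' i).2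
  have my := fun i => (hW _).1 (y' i).2
  have mx1 := fun i => (real_inner_comm _ _).trans ((hW _).1 (x' i).2).1
  have mx2 := fun i => (real_inner_comm _ _).trans ((hW _).1 (x' i).2).2
  have my2 := fun i => (real_inner_comm _ _).trans ((hW _).1 (y' i).2).2
  refine ⟨d + 1, Fin.cons x fun i => x' i, Fin.cons y fun i => y' i, Fin.cons a a', ?_⟩
  simp only [Fin.forall_fin_succ, Fin.cons_zero, Fin.cons_succ, Fin.succ_inj, hx, hy, hxy, mx, my,
    mx1, mx2, my2, ha, ha', hAx, hAy, ← Submodule.coe_inner, hx', hy', hxy']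
  simp only [Fin.succ_ne_zero, (Fin.succ_ne_zero _).symm, if_true, if_false, implies_true, true_and,
    and_true]
  refine ⟨fun i => congrArg Subtype.val (hAx' i), fun i => congrArg Subtype.val (hAy' i), ?_⟩
  rintro w ⟨h1, h2⟩ ⟨h3, h4⟩
  exact congrArg Subtype.val (hw' ⟨w, (hW w).2 ⟨h1, h3⟩⟩ h2 h4)

theorem exists_adapted_orthonormalBasis {E : Type*} [NormedAddCommGroup E]
    [InnerProductSpace ℝ E] [FiniteDimensional ℝ E] {n k : ℕ} (A : E →ₗ[ℝ] E)
    (hA : ∀ x y, inner ℝ (A x) y = -inner ℝ x (A y)) (hn : finrank ℝ E = n)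
    (K : Submodule ℝ E) (hk : finrank ℝ K = k) (hK : ∀ w ∈ K, A w = 0) :
    ∃ (d : ℕ) (hd : 2 * d + k ≤ n) (a : Fin d → ℝ) (b : OrthonormalBasis (Fin n) ℝ E),
      (∀ j, 0 < a j) ∧
      (∀ j : Fin d, A (b ⟨2 * j, by omega⟩) = a j • b ⟨2 * j + 1, by omega⟩) ∧
      (∀ j : Fin d, A (b ⟨2 * j + 1, by omega⟩) = -(a j • b ⟨2 * j, by omega⟩)) ∧
      (∀ i : Fin n, 2 * d ≤ i → A (b i) = 0) ∧
      (∀ i : Fin n, i + k < n → b i ∈ Kᗮ) ∧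
      ∀ i : Fin n, n ≤ i + k → b i ∈ K := by
  obtain ⟨d, x, y, a, ha, hx, hy, hxy, hAx, hAy, hw⟩ := exists_orthonormal_pairs_of_skew n A hA hn
  let f := (stdOrthonormalBasis ℝ K).reindex (finCongr hk)
  have hf : ∀ i j, inner ℝ (f i : E) (f j) = if i = j then (1 : ℝ) else 0 := fun i j => by
    rw [← Submodule.coe_inner]
    exact orthonormal_iff_ite.1 f.orthonormal i j
  have hyK : ∀ w ∈ K, ∀ i, inner ℝ w (y i) = (0 : ℝ) := fun w hwK i => by
    have h := hA w (x i)
    rw [hK w hwK, hAx, inner_zero_left, inner_smul_right] at h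
    simpa [(ha i).ne'] using h
  have hxK : ∀ w ∈ K, ∀ i, inner ℝ w (x i) = (0 : ℝ) := fun w hwK i => by
    have h := hA w (y i)
    rw [hK w hwK, hAy, inner_zero_left, inner_neg_right, inner_smul_right] at h
    simpa [(ha i).ne'] using h
  let u : (Fin d ⊕ Fin d) ⊕ Fin k → E := Sum.elim (Sum.elim x y) (fun i => f i)
  have hu : Orthonormal ℝ u := by
    rw [orthonormal_iff_ite]
    rintro ((i | i) | i) ((j | j) | j) <;>
      simp [u, hx, hy, hf, hxy, hxK, hyK, real_inner_comm (x _), real_inner_comm (f _ : E) (x _),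
        real_inner_comm (f _ : E) (y _)]
  have hd : 2 * d + k ≤ n := by
    have := hu.linearIndependent.fintype_card_le_finrank
    simp only [Fintype.card_sum, Fintype.card_fin] at this
    omega
  let e : (Fin d ⊕ Fin d) ⊕ Fin k → Fin n := Sum.elim
    (Sum.elim (fun j => ⟨2 * j, by omega⟩) (fun j => ⟨2 * j + 1, by omega⟩))
    (fun i => ⟨n - k + i, by omega⟩)
  have he : Function.Injective e := by
    rintro ((i | i) | i) ((j | j) | j) h <;>
      simp only [e, Sum.elim_inl, Sum.elim_inr, Fin.mk.injEq] at h <;>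
      simp only [Sum.inl.injEq, Sum.inr.injEq, reduceCtorEq, Fin.ext_iff] <;> omega
  have hv : Orthonormal ℝ ((Set.range e).domRestrict (Function.extend e u 0)) := by
    convert hu.comp _ (Equiv.ofInjective e he).symm.injective
    ext i
    obtain ⟨i, rfl⟩ := (Equiv.ofInjective e he).surjective i
    simp [he.extend_apply]
  obtain ⟨b, hb⟩ := hv.exists_orthonormalBasis_extension_of_card_eq (by simpa using hn)
  have hb' : ∀ i, b (e i) = u i := fun i => by rw [hb _ ⟨i, rfl⟩, he.extend_apply]
  have hbx : ∀ j : Fin d, b ⟨2 * j, by omega⟩ = x j := fun j => hb' (.inl (.inl j))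
  have hby : ∀ j : Fin d, b ⟨2 * j + 1, by omega⟩ = y j := fun j => hb' (.inl (.inr j))
  have hbf : ∀ j : Fin k, b ⟨n - k + j, by omega⟩ = f j := fun j => hb' (.inr j)
  have hbo : ∀ i j, i ≠ j → inner ℝ (b i) (b j) = (0 : ℝ) := fun i j h => b.orthonormal.2 h
  refine ⟨d, hd, a, b, ha, ?_, ?_, ?_, ?_, ?_⟩
  · intro j
    rw [hbx, hby, hAx]
  · intro j
    rw [hbx, hby, hAy]
  · intro i hi
    refine hw _ (fun j => ?_) fun j => ?_
    · rw [← hbx]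
      exact hbo _ _ (by rw [Ne, Fin.ext_iff]; dsimp only; omega)
    · rw [← hby]
      exact hbo _ _ (by rw [Ne, Fin.ext_iff]; dsimp only; omega)
  · intro i hi
    rw [Submodule.mem_orthogonal]
    intro w hwK
    have h := congrArg Subtype.val (f.sum_repr ⟨w, hwK⟩)
    rw [← show _ = w from h]
    simp only [Submodule.coe_sum, Submodule.coe_smul, sum_inner, inner_smul_left]
    refine Finset.sum_eq_zero fun j _ => ?_
    rw [← hbf, hbo _ _ (by rw [Ne, Fin.ext_iff]; dsimp only; omega), mul_zero]
  · intro i hi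
    have h := hbf ⟨i - (n - k), by omega⟩
    have hi' : (⟨n - k + (i - (n - k)), by omega⟩ : Fin n) = i := by
      ext; dsimp only; omega
    dsimp only at h
    rw [hi'] at h
    rw [h]
    exact (f _).2

theorem add_add_nonneg_of_posSemidef {ι : Type*} [Fintype ι] (μ Δ : Matrix ι ι ℝ)
    (hΔ : Δᵀ = -Δ)
    (hpsd : (μ.map Complex.ofReal - (Complex.I / 2) • Δ.map Complex.ofReal).PosSemidef)
    (x y : ι → ℝ) : 0 ≤ x ⬝ᵥ μ *ᵥ x + y ⬝ᵥ μ *ᵥ y + x ⬝ᵥ Δ *ᵥ y := by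
  have h := (Complex.le_def.1 (hpsd.dotProduct_mulVec_nonneg fun i => ⟨x i, y i⟩)).1
  have hs : y ⬝ᵥ Δ *ᵥ x = -(x ⬝ᵥ Δ *ᵥ y) := by
    rw [dotProduct_mulVec, ← mulVec_transpose, hΔ, neg_mulVec, neg_dotProduct, dotProduct_comm]
  have key : x ⬝ᵥ μ *ᵥ x + y ⬝ᵥ μ *ᵥ y + (x ⬝ᵥ Δ *ᵥ y - y ⬝ᵥ Δ *ᵥ x) / 2 =
      (star (fun i => (⟨x i, y i⟩ : ℂ)) ⬝ᵥ
        (μ.map Complex.ofReal - (Complex.I / 2) • Δ.map Complex.ofReal) *ᵥ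
          fun i => (⟨x i, y i⟩ : ℂ)).re := by
    simp only [dotProduct, mulVec, Finset.mul_sum, Complex.re_sum, ← Finset.sum_add_distrib,
      ← Finset.sum_sub_distrib, Finset.sum_div]
    refine Finset.sum_congr rfl fun i _ => Finset.sum_congr rfl fun j _ => ?_
    simp
    ring
  rw [hs] at key
  rw [← key] at h
  simp only [Complex.zero_re] at h
  linarith

theorem exists_congruent_idempotent {ι : Type*} [Fintype ι] [DecidableEq ι] (μ : Matrix ι ι ℝ)
    (hμ : μ.PosSemidef) :
    ∃ P D : Matrix ι ι ℝ, IsUnit P.det ∧ Pᵀ * μ * P = D ∧ Dᵀ = D ∧ D * D = D := by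
  let U : Matrix ι ι ℝ := hμ.1.eigenvectorUnitary
  let l := hμ.1.eigenvalues
  have hU : Uᵀ * U = 1 := by
    simpa [U, star_eq_conjTranspose] using Unitary.coe_star_mul_self hμ.1.eigenvectorUnitary
  have hl : ∀ i, 0 ≤ l i := hμ.eigenvalues_nonneg
  have hspec : μ = U * diagonal l * Uᵀ := by
    have h := hμ.1.spectral_theorem
    simpa [Unitary.conjStarAlgAut_apply, star_eq_conjTranspose] using h
  let t : ι → ℝ := fun i => if l i = 0 then 1 else (√(l i))⁻¹
  have ht : ∀ i, t i ≠ 0 := fun i => by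
    by_cases h : l i = 0
    · simp [t, h]
    · simp [t, h, Real.sqrt_ne_zero (hl i)]
  refine ⟨U * diagonal t, diagonal fun i => if l i = 0 then 0 else 1, ?_, ?_, ?_, ?_⟩
  · rw [det_mul, det_diagonal]
    exact (isUnit_det_of_left_inverse hU).mul (Finset.prod_ne_zero_iff.2 fun i _ => ht i).isUnit
  · calc (U * diagonal t)ᵀ * μ * (U * diagonal t)
        = diagonal t * (Uᵀ * U) * diagonal l * (Uᵀ * U) * diagonal t := by
          rw [hspec]
          simp only [transpose_mul, diagonal_transpose, Matrix.mul_assoc]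
      _ = _ := by
          rw [hU]
          simp only [Matrix.mul_one, diagonal_mul_diagonal]
          congr 1
          funext i
          by_cases h : l i = 0
          · simp [h]
          · simp only [t, h, if_false]
            have := Real.sqrt_ne_zero'.2 ((hl i).lt_of_ne' h)
            field_simp
            exact (Real.sq_sqrt (hl i)).symm
  · simp
  · rw [diagonal_mul_diagonal]
    simp

theorem transpose_mul_mul_apply_orthonormalBasis {ι : Type*} [Fintype ι] [DecidableEq ι]
    (b : OrthonormalBasis ι ℝ (EuclideanSpace ℝ ι)) (X : Matrix ι ι ℝ) (i j : ι) :
    ((of fun i j => b j i)ᵀ * X * (of fun i j => b j i)) i j =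
      inner ℝ (b i) (toLpLin 2 2 X (b j)) := by
  rw [toLpLin_apply, EuclideanSpace.inner_eq_star_dotProduct, dotProduct_comm, Matrix.mul_assoc]
  rfl

theorem inner_toLpLin_congr {ι : Type*} [Fintype ι] [DecidableEq ι] (P X : Matrix ι ι ℝ)
    (x y : EuclideanSpace ℝ ι) :
    inner ℝ x (toLpLin 2 2 (Pᵀ * X * P) y) = (P *ᵥ x.ofLp) ⬝ᵥ X *ᵥ (P *ᵥ y.ofLp) := by
  rw [toLpLin_apply, EuclideanSpace.inner_eq_star_dotProduct, dotProduct_comm, star_trivial,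
    ← mulVec_mulVec, ← mulVec_mulVec, dotProduct_mulVec, vecMul_transpose]

theorem mem_orthogonal_ker_of_idempotent {E : Type*} [NormedAddCommGroup E]
    [InnerProductSpace ℝ E] (D : E →ₗ[ℝ] E) (hD : D.IsSymmetric) (hDD : ∀ v, D (D v) = D v)
    {v : E} (hv : v ∈ D.kerᗮ) : D v = v := by
  have hk : v - D v ∈ D.ker := by simp [hDD]
  have h1 : inner ℝ (v - D v) v = (0 : ℝ) := (Submodule.mem_orthogonal _ _).1 hv _ hk
  have h2 : inner ℝ (v - D v) (D v) = (0 : ℝ) := by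
    rw [← hD, map_sub, hDD, sub_self, inner_zero_left]
  have h3 : inner ℝ (v - D v) (v - D v) = (0 : ℝ) := by rw [inner_sub_right, h1, h2, sub_zero]
  exact (sub_eq_zero.1 (inner_self_eq_zero.1 h3)).symm

theorem rank_symplectic_blocks {n d : ℕ} (hd : 2 * d ≤ n) (Ω : Matrix (Fin n) (Fin n) ℝ)
    (hΩ : Ω = Matrix.of (fun i j : Fin n =>
      if (i : ℕ) < 2 * d ∧ (j : ℕ) < 2 * d then
        (if (j : ℕ) = (i : ℕ) + 1 ∧ (i : ℕ) % 2 = 0 then -1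
         else if (i : ℕ) = (j : ℕ) + 1 ∧ (j : ℕ) % 2 = 0 then 1 else 0)
      else 0)) : Ω.rank = 2 * d := by
  have h : Ωᵀ * Ω = diagonal fun i : Fin n => if (i : ℕ) < 2 * d then (1 : ℝ) else 0 := by
    ext i j
    rw [mul_apply, hΩ]
    by_cases hi : (i : ℕ) < 2 * d
    · let p : Fin n := ⟨if (i : ℕ) % 2 = 0 then i + 1 else i - 1, by split_ifs <;> omega⟩
      have hp : (p : ℕ) = if (i : ℕ) % 2 = 0 then (i : ℕ) + 1 else i - 1 := rfl
      clear_value p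
      rw [Finset.sum_eq_single p]
      · simp only [transpose_apply, of_apply, diagonal_apply, Fin.ext_iff]
        split_ifs at hp ⊢ <;> first | omega | norm_num
      · intro k _ hk
        rw [Ne, Fin.ext_iff] at hk
        refine mul_eq_zero_of_left ?_ _
        simp only [transpose_apply, of_apply]
        split_ifs at hp ⊢ <;> first | omega | rfl
      · simp
    · rw [Finset.sum_eq_zero fun k _ => by simp [hi]]
      simp [diagonal_apply, hi]
  rw [← rank_transpose_mul_self, h, rank_diagonal]
  have : Fintype.card {i : Fin n // (i : ℕ) < 2 * d} = 2 * d := by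
    rw [Fintype.card_subtype]
    simpa [hd] using Fin.card_filter_val_lt (n := n) (m := 2 * d)
  convert this using 4
  simp

/-- **generalized Williamson lemma.** If `μ` is real symmetric,
`Δ_K` real skew-symmetric, and `μ - (i/2)Δ_K ≥ 0` (as a complex Hermitian matrix),
then there is an invertible real `T` with
`TᵗμT = diag(μ̃, I/2, 0)` and `TᵗΔ_K T = diag(Δ, 0, 0)`, where the first block has
size `rank Δ_K = 2d`, `Δ` is a direct sum of standard symplectic blocks
`[[0,-1],[1,0]]`, `μ̃` consists of `2×2` blocks `μ_j I₂` with `μ_j ≥ 1/2`, the second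
block (of `1/2` entries) has size `rank μ − rank Δ_K`, and the third block has size
`2s − rank μ`. -/
theorem generalized_williamson
    (s : ℕ) (μ ΔK : Matrix (Fin (2 * s)) (Fin (2 * s)) ℝ)
    (hμ : μ.IsSymm) (hΔ : ΔKᵀ = -ΔK)
    (hpsd : (μ.map (Complex.ofReal) - (Complex.I / 2) • ΔK.map (Complex.ofReal)).PosSemidef) :
    ∃ (T : Matrix (Fin (2 * s)) (Fin (2 * s)) ℝ), IsUnit T.det ∧
      ∃ (d : ℕ) (hd : 2 * d = ΔK.rank) (c : Fin d → ℝ),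
        (∀ j, (1 : ℝ) / 2 ≤ c j) ∧
        Tᵀ * μ * T = Matrix.of (fun i j : Fin (2 * s) =>
          if (i : ℕ) = (j : ℕ) then
            (if h : (i : ℕ) < 2 * d then c ⟨(i : ℕ) / 2, by omega⟩
             else if (i : ℕ) < μ.rank then 1 / 2 else 0)
          else 0) ∧
        Tᵀ * ΔK * T = Matrix.of (fun i j : Fin (2 * s) =>
          if (i : ℕ) < 2 * d ∧ (j : ℕ) < 2 * d then
            (if (j : ℕ) = (i : ℕ) + 1 ∧ (i : ℕ) % 2 = 0 then -1
             else if (i : ℕ) = (j : ℕ) + 1 ∧ (j : ℕ) % 2 = 0 then 1 else 0)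
          else 0) := by
  have hineq := add_add_nonneg_of_posSemidef μ ΔK hΔ hpsd
  have hμpsd : μ.PosSemidef := by
    refine PosSemidef.of_dotProduct_mulVec_nonneg
      ((conjTranspose_eq_transpose_of_trivial μ).trans hμ) fun x => ?_
    simpa using hineq x 0
  obtain ⟨P, D, hP, hPD, hDt, hDD⟩ := exists_congruent_idempotent μ hμpsd
  let δ := toLpLin 2 2 D
  let A := toLpLin 2 2 (Pᵀ * ΔK * P)
  have hδ : δ.IsSymmetric := fun x y => by
    simp only [δ, toLpLin_apply, EuclideanSpace.inner_eq_star_dotProduct, star_trivial]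
    rw [dotProduct_mulVec, ← mulVec_transpose, hDt, dotProduct_comm]
  have hδδ : ∀ v, δ (δ v) = δ v := fun v => by
    simp only [δ, toLpLin_apply, mulVec_mulVec, hDD]
  have hA : ∀ x y, inner ℝ (A x) y = -inner ℝ x (A y) := fun x y => by
    simp only [A, toLpLin_apply, EuclideanSpace.inner_eq_star_dotProduct, star_trivial]
    rw [dotProduct_mulVec, ← mulVec_transpose, transpose_mul, transpose_mul, hΔ,
      transpose_transpose, ← neg_dotProduct, ← neg_mulVec]
    simp [Matrix.mul_assoc]
  have hineqE : ∀ x y, 0 ≤ inner ℝ x (δ x) + inner ℝ y (δ y) + inner ℝ x (A y) := fun x y => by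
    have h := hineq (P *ᵥ x) (P *ᵥ y)
    simp only [← inner_toLpLin_congr] at h
    rwa [hPD] at h
  have hK : ∀ w ∈ δ.ker, A w = 0 := by
    intro w hw
    rw [LinearMap.mem_ker] at hw
    by_contra h0
    have hpos : 0 < inner ℝ (A w) (A w) := real_inner_self_pos.2 h0
    have h := hineqE (A w) (-((inner ℝ (A w) (δ (A w)) + 1) / inner ℝ (A w) (A w)) • w)
    simp only [map_smul, hw, smul_zero, inner_zero_right, inner_smul_right] at h
    field_simp at h
    linarith
  have hrank : μ.rank = D.rank := by
    rw [← hPD, rank_mul_eq_left_of_isUnit_det _ _ hP,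
      rank_mul_eq_right_of_isUnit_det _ _ (by rwa [det_transpose])]
  have hker : finrank ℝ δ.ker + μ.rank = 2 * s := by
    have h1 : D.rank = finrank ℝ δ.range := by
      rw [D.rank_eq_finrank_range_toLin (PiLp.basisFun 2 ℝ _) (PiLp.basisFun 2 ℝ _)]
      rfl
    rw [hrank, h1, add_comm, LinearMap.finrank_range_add_finrank_ker]
    simp
  obtain ⟨d, hd, a, b, ha, hAe, hAo, hAz, hbo, hbk⟩ :=
    exists_adapted_orthonormalBasis (n := 2 * s) A hA (by simp) δ.ker rfl hK
  have hδb : ∀ i : Fin (2 * s), δ (b i) = if (i : ℕ) < μ.rank then b i else 0 := by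
    intro i
    split_ifs with h
    · exact mem_orthogonal_ker_of_idempotent δ hδ hδδ (hbo i (by omega))
    · exact hbk i (by omega)
  have hbb : ∀ i j, inner ℝ (b i) (b j) = if (i : ℕ) = (j : ℕ) then (1 : ℝ) else 0 := by
    intro i j
    rw [orthonormal_iff_ite.1 b.orthonormal]
    simp only [Fin.ext_iff]
  let M : Matrix (Fin (2 * s)) (Fin (2 * s)) ℝ := of fun i j => b j i
  have hM : IsUnit M.det := by
    refine isUnit_det_of_left_inverse (B := Mᵀ) ?_
    ext i j
    have h := transpose_mul_mul_apply_orthonormalBasis b 1 i j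
    rw [Matrix.mul_one] at h
    rw [h, toLpLin_one, LinearMap.id_apply, hbb, one_apply]
    simp only [Fin.ext_iff]
  let t : Fin (2 * s) → ℝ := fun i =>
    if h : (i : ℕ) < 2 * d then (√(a ⟨i / 2, by omega⟩))⁻¹ else (√2)⁻¹
  have hsq : ∀ j, √(a j) ≠ 0 := fun j => Real.sqrt_ne_zero'.2 (ha j)
  have ht : ∀ i, t i ≠ 0 := fun i => by
    simp only [t]
    split_ifs
    · exact inv_ne_zero (hsq _)
    · simp
  have hT : IsUnit (P * M * diagonal t).det := by
    rw [det_mul, det_mul, det_diagonal]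
    exact (hP.mul hM).mul (Finset.prod_ne_zero_iff.2 fun i _ => ht i).isUnit
  have hentry : ∀ X i j, ((P * M * diagonal t)ᵀ * X * (P * M * diagonal t)) i j =
      t i * inner ℝ (b i) (toLpLin 2 2 (Pᵀ * X * P) (b j)) * t j := by
    intro X i j
    rw [← transpose_mul_mul_apply_orthonormalBasis, ← diagonal_mul, ← mul_diagonal]
    simp only [transpose_mul, diagonal_transpose, Matrix.mul_assoc]
    rfl
  have hΩ : (P * M * diagonal t)ᵀ * ΔK * (P * M * diagonal t) =
      Matrix.of (fun i j : Fin (2 * s) =>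
        if (i : ℕ) < 2 * d ∧ (j : ℕ) < 2 * d then
          (if (j : ℕ) = (i : ℕ) + 1 ∧ (i : ℕ) % 2 = 0 then -1
           else if (i : ℕ) = (j : ℕ) + 1 ∧ (j : ℕ) % 2 = 0 then 1 else 0)
        else 0) := by
    ext i j
    rw [hentry, of_apply]
    change t i * inner ℝ (b i) (A (b j)) * t j = _
    by_cases hj : (j : ℕ) < 2 * d
    · obtain ⟨m, hm⟩ : ∃ m : Fin d, (m : ℕ) = j / 2 := ⟨⟨j / 2, by omega⟩, rfl⟩
      have hti : ∀ i : Fin (2 * s), (i : ℕ) / 2 = m → t i = (√(a m))⁻¹ := by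
        intro i hi
        simp only [t, dif_pos (show (i : ℕ) < 2 * d by omega), hi]
      have hscale : (√(a m))⁻¹ * a m * (√(a m))⁻¹ = 1 := by
        have := hsq m
        field_simp
        exact (Real.sq_sqrt (ha m).le).symm
      rcases Nat.mod_two_eq_zero_or_one j with h2 | h2
      · have hjm : j = ⟨2 * m, by omega⟩ := by ext; dsimp only; omega
        rw [hti j hm.symm, hjm, hAe, inner_smul_right, hbb]
        dsimp only
        by_cases him : (i : ℕ) = 2 * m + 1
        · rw [if_pos him, hti i (by omega), mul_one, hscale, if_pos (by omega),
            if_neg (by omega), if_pos (by omega)]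
        · rw [if_neg him]
          split_ifs <;> first | omega | simp
      · have hjm : j = ⟨2 * m + 1, by omega⟩ := by ext; dsimp only; omega
        rw [hti j hm.symm, hjm, hAo, inner_neg_right, inner_smul_right, hbb]
        dsimp only
        by_cases him : (i : ℕ) = 2 * m
        · rw [if_pos him, hti i (by omega), mul_one, mul_neg, neg_mul, hscale,
            if_pos (by omega), if_pos (by omega)]
        · rw [if_neg him]
          split_ifs <;> first | omega | simp
    · rw [hAz j (by omega), if_neg (by tauto)]
      simp
  have hrankΔ : 2 * d = ΔK.rank := by
    rw [← rank_symplectic_blocks (by omega) _ hΩ, rank_mul_eq_left_of_isUnit_det _ _ hT,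
      rank_mul_eq_right_of_isUnit_det _ _ (by rwa [det_transpose])]
  refine ⟨P * M * diagonal t, hT, d, hrankΔ, fun j => (a j)⁻¹, fun j => ?_, ?_, hΩ⟩
  · have h := hineqE (b ⟨2 * j, by omega⟩) (b ⟨2 * j + 1, by omega⟩)
    rw [hAo, hδb, hδb, if_pos (by dsimp only; omega), if_pos (by dsimp only; omega),
      inner_neg_right, inner_smul_right, hbb, hbb, if_pos rfl, if_pos rfl] at h
    rw [one_div]
    exact inv_anti₀ (ha j) (by linarith)
  · ext i j
    rw [hentry, of_apply, hPD]
    change t i * inner ℝ (b i) (δ (b j)) * t j = _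
    rw [hδb]
    by_cases hij : (i : ℕ) = j
    · obtain rfl := Fin.ext hij
      rw [if_pos rfl]
      by_cases hi : (i : ℕ) < 2 * d
      · rw [dif_pos hi, if_pos (by omega), hbb, if_pos rfl]
        simp only [t, dif_pos hi, mul_one]
        rw [← mul_inv, Real.mul_self_sqrt (ha _).le]
      · rw [dif_neg hi]
        simp only [t, dif_neg hi]
        split_ifs
        · rw [hbb, if_pos rfl, mul_one, ← mul_inv, Real.mul_self_sqrt (by norm_num), one_div]
        · simp
    · rw [if_neg hij]
      split_ifs
      · rw [hbb, if_neg hij, mul_zero, zero_mul]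
      · simp
end

section
/- Let μ be a real symmetric positive definite 2s×2s matrix and Δ a nondegenerate real skew-symmetric 2s×2s matrix with μ − (i/2)Δ ≥ 0. Then the matrix Δ^{-1}μ has purely imaginary eigenvalues ±iμ_j with μ_j ≥ 1/2 for j = 1,…,s, and det(abs(Δ^{-1}μ) + I/2) = Π_{j=1}^s (μ_j + 1/2)^2, where abs denotes the absolute value of the diagonalizable operator Δ^{-1}μ. -/
open Matrix
open scoped ComplexOrder

open scoped InnerProductSpace in
theorem exists_orthogonal_pairs_of_skew {V : Type*} [NormedAddCommGroup V] [InnerProductSpace ℝ V]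
    [FiniteDimensional ℝ V] (K : V →ₗ[ℝ] V) (hK : ∀ x y, ⟪K x, y⟫_ℝ = -⟪x, K y⟫_ℝ)
    (hinj : Function.Injective K) (s : ℕ) (hs : 2 * s ≤ Module.finrank ℝ V) :
    ∃ (p q : Fin s → V) (c : Fin s → ℝ), (∀ i, 0 < c i) ∧ (∀ i, p i ≠ 0) ∧ (∀ i, q i ≠ 0) ∧
      (∀ i j, i ≠ j → ⟪p i, p j⟫_ℝ = 0) ∧ (∀ i j, i ≠ j → ⟪q i, q j⟫_ℝ = 0) ∧
      (∀ i j, ⟪p i, q j⟫_ℝ = 0) ∧ (∀ i, K (p i) = -(c i • q i)) ∧ (∀ i, K (q i) = c i • p i) := by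
  induction s with
  | zero => exact ⟨Fin.elim0, Fin.elim0, Fin.elim0, by simp⟩
  | succ s ih =>
    obtain ⟨p, q, c, hc, hp, hq, hpp, hqq, hpq, hKp, hKq⟩ := ih (by omega)
    let S := Submodule.span ℝ (Set.range (Sum.elim p q))
    have hmem : ∀ x, x ∈ Sᗮ ↔ ∀ i, ⟪p i, x⟫_ℝ = 0 ∧ ⟪q i, x⟫_ℝ = 0 := by
      intro x
      constructor
      · intro hx i
        exact ⟨hx _ (Submodule.subset_span ⟨Sum.inl i, rfl⟩),
          hx _ (Submodule.subset_span ⟨Sum.inr i, rfl⟩)⟩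
      · intro hx u hu
        induction hu using Submodule.span_induction with
        | mem u hu =>
          obtain ⟨i | i, rfl⟩ := hu
          · exact (hx i).1
          · exact (hx i).2
        | zero => simp
        | add u v _ _ hu hv => simp [inner_add_left, hu, hv]
        | smul a u _ hu => simp [inner_smul_left, hu]
    have hinv : ∀ x ∈ Sᗮ, K x ∈ Sᗮ := by
      intro x hx
      rw [hmem] at hx ⊢
      intro i
      have h1 := hK (p i) x
      have h2 := hK (q i) x
      rw [hKp, inner_neg_left, inner_smul_left, (hx i).2] at h1
      rw [hKq, inner_smul_left, (hx i).1] at h2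
      exact ⟨by simpa using h1.symm, by simpa using h2.symm⟩
    have hinv2 : ∀ x ∈ Sᗮ, (K ∘ₗ K) x ∈ Sᗮ := fun x hx => hinv _ (hinv x hx)
    have hsymm : (K ∘ₗ K).IsSymmetric := by
      intro x y
      simp [hK]
    have hnt : Nontrivial Sᗮ := by
      apply Module.nontrivial_of_finrank_pos (R := ℝ)
      have h1 : Module.finrank ℝ S ≤ 2 * s := by
        have := finrank_range_le_card (R := ℝ) (Sum.elim p q)
        simp only [Fintype.card_sum, Fintype.card_fin] at this
        change Module.finrank ℝ S ≤ _ at this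
        omega
      have h2 := S.finrank_add_finrank_orthogonal
      omega
    obtain ⟨l, hl⟩ : ∃ l, Module.End.HasEigenvalue ((K ∘ₗ K).restrict hinv2) l := by
      by_contra! h
      have := (hsymm.restrict_invariant hinv2).subsingleton_of_no_eigenvalue_finiteDimensional
        (fun l => by simpa [Module.End.HasEigenvalue, Module.End.HasUnifEigenvalue] using h l)
      exact not_subsingleton _ this
    obtain ⟨⟨v, hvS⟩, hv, hv0⟩ := hl.exists_hasEigenvector
    rw [Module.End.mem_eigenspace_iff] at hv
    have hv : K (K v) = l • v := congrArg Subtype.val hv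
    have hv0 : v ≠ 0 := fun h => hv0 (Subtype.ext h)
    have hKv0 : K v ≠ 0 := fun h => hv0 (hinj (by simpa using h))
    have hl0 : l < 0 := by
      have h := hK (K v) v
      rw [hv, inner_smul_left] at h
      have h1 : 0 < ⟪v, v⟫_ℝ := real_inner_self_pos.2 hv0
      have h2 : 0 < ⟪K v, K v⟫_ℝ := real_inner_self_pos.2 hKv0
      simp only [conj_trivial] at h
      by_contra! h3
      nlinarith [mul_nonneg h3 h1.le]
    have hd : 0 < √(-l) := Real.sqrt_pos.2 (by linarith)
    have hd2 : √(-l) * √(-l) = -l := Real.mul_self_sqrt (by linarith)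
    set d := √(-l)
    obtain ⟨w, hw⟩ : ∃ w, w = -(d⁻¹ • K v) := ⟨_, rfl⟩
    have hwS : w ∈ Sᗮ := hw ▸ Sᗮ.neg_mem (Sᗮ.smul_mem _ (hinv v hvS))
    have hKvw : K v = -(d • w) := by simp [hw, smul_smul, hd.ne']
    have hw0 : w ≠ 0 := by
      rintro rfl
      exact hKv0 (by simpa using hKvw)
    have hKw : K w = d • v := by
      rw [hw, map_neg, map_smul, hv, smul_smul, ← neg_smul]
      congr 1
      field_simp
      linarith
    have hvw : ⟪v, w⟫_ℝ = 0 := by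
      have h := hK v v
      rw [real_inner_comm] at h
      have h : ⟪v, K v⟫_ℝ = 0 := by linarith
      simpa [hw, inner_neg_right, inner_smul_right] using Or.inr h
    rw [hmem] at hvS hwS
    have hvS' : ∀ i, ⟪v, p i⟫_ℝ = 0 ∧ ⟪v, q i⟫_ℝ = 0 := fun i => by
      simpa only [real_inner_comm v] using hvS i
    have hwS' : ∀ i, ⟪w, p i⟫_ℝ = 0 ∧ ⟪w, q i⟫_ℝ = 0 := fun i => by
      simpa only [real_inner_comm w] using hwS i
    refine ⟨Fin.cons v p, Fin.cons w q, Fin.cons d c, ?_, ?_, ?_, ?_, ?_, ?_, ?_, ?_⟩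
    · simpa [Fin.forall_fin_succ] using ⟨hd, hc⟩
    · simpa [Fin.forall_fin_succ] using ⟨hv0, hp⟩
    · simpa [Fin.forall_fin_succ] using ⟨hw0, hq⟩
    · simpa [Fin.forall_fin_succ, forall_and, hvS, hvS'] using hpp
    · simpa [Fin.forall_fin_succ, forall_and, hwS, hwS'] using hqq
    · simpa [Fin.forall_fin_succ, forall_and, hwS, hvS', hvw] using hpq
    · simpa [Fin.forall_fin_succ] using ⟨hKvw, hKp⟩
    · simpa [Fin.forall_fin_succ] using ⟨hKw, hKq⟩

theorem prod_fin_two_mul_div_two (s : ℕ) (c : Fin s → ℝ) :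
    ∏ i : Fin (2 * s), c ⟨(i : ℕ) / 2, by omega⟩ = ∏ j, c j ^ 2 := by
  induction s with
  | zero => simp
  | succ s ih =>
    rw [Fin.prod_univ_castSucc, ← ih (fun j => c j.castSucc)]
    change ∏ i : Fin (2 * s + 1 + 1), c ⟨(i : ℕ) / 2, by omega⟩ = _
    rw [Fin.prod_univ_castSucc, Fin.prod_univ_castSucc, mul_assoc, pow_two]
    congr 2 <;> congr 1 <;> ext <;> simp <;> omega

theorem real_nonneg_of_posSemidef {n : Type*} [Fintype n] {μ Δ : Matrix n n ℝ}
    (hΔs : Δᵀ = -Δ)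
    (hpsd : (μ.map (Complex.ofReal) - (Complex.I / 2) • Δ.map (Complex.ofReal)).PosSemidef)
    (x y : n → ℝ) : 0 ≤ x ⬝ᵥ μ *ᵥ x + y ⬝ᵥ μ *ᵥ y + x ⬝ᵥ Δ *ᵥ y := by
  have h := (Complex.nonneg_iff.1
    (hpsd.dotProduct_mulVec_nonneg (fun i => (x i : ℂ) + Complex.I * y i))).1
  have hyx : y ⬝ᵥ Δ *ᵥ x = -(x ⬝ᵥ Δ *ᵥ y) := by
    rw [dotProduct_mulVec, ← mulVec_transpose, hΔs, dotProduct_comm, neg_mulVec, dotProduct_neg]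
  have key : x ⬝ᵥ μ *ᵥ x + y ⬝ᵥ μ *ᵥ y + x ⬝ᵥ Δ *ᵥ y =
    x ⬝ᵥ μ *ᵥ x + y ⬝ᵥ μ *ᵥ y + (1 / 2) * (x ⬝ᵥ Δ *ᵥ y - y ⬝ᵥ Δ *ᵥ x) := by rw [hyx]; ring
  rw [key]
  convert h using 1
  simp only [dotProduct, mulVec, Finset.mul_sum, Complex.re_sum, ← Finset.sum_add_distrib,
    ← Finset.sum_sub_distrib]
  refine Finset.sum_congr rfl fun i _ => Finset.sum_congr rfl fun j _ => ?_
  simp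
  ring

open scoped MatrixOrder in
theorem Matrix.PosDef.exists_isUnit_transpose_mul_self {n : Type*} [Fintype n] [DecidableEq n]
    {μ : Matrix n n ℝ} (hμ : μ.PosDef) : ∃ B : Matrix n n ℝ, IsUnit B.det ∧ μ = Bᵀ * B := by
  obtain ⟨B, hB⟩ := CStarAlgebra.nonneg_iff_eq_star_mul_self.1
    (Matrix.nonneg_iff_posSemidef.2 hμ.posSemidef)
  have hB : μ = Bᵀ * B := by
    rw [hB, star_eq_conjTranspose, conjTranspose_eq_transpose_of_trivial]
  refine ⟨B, ?_, hB⟩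
  have h := (isUnit_iff_isUnit_det _).1 hμ.isUnit
  rw [hB, det_mul] at h
  exact isUnit_of_mul_isUnit_right h

/-- Williamson normal form, in terms of the columns of the diagonalizing matrix. -/
theorem exists_williamson_columns {s : ℕ} {μ Δ : Matrix (Fin (2 * s)) (Fin (2 * s)) ℝ}
    (hμ : μ.PosDef) (hΔs : Δᵀ = -Δ) (hΔ : IsUnit Δ.det) :
    ∃ (p q : Fin s → Fin (2 * s) → ℝ) (c : Fin s → ℝ), (∀ i, 0 < c i) ∧
      LinearIndependent ℝ (fun i : Fin (2 * s) =>
        if (i : ℕ) % 2 = 0 then p ⟨(i : ℕ) / 2, by omega⟩ else q ⟨(i : ℕ) / 2, by omega⟩) ∧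
      (∀ i, (Δ⁻¹ * μ) *ᵥ p i = -(c i • q i)) ∧ (∀ i, (Δ⁻¹ * μ) *ᵥ q i = c i • p i) := by
  obtain ⟨B, hB, rfl⟩ := hμ.exists_isUnit_transpose_mul_self
  have hBT : IsUnit Bᵀ.det := by rwa [det_transpose]
  obtain ⟨M, hM⟩ : ∃ M, M = B * Δ⁻¹ * Bᵀ := ⟨_, rfl⟩
  have hMT : Mᵀ = -M := by
    have h : (-Δ)⁻¹ = -Δ⁻¹ := inv_eq_left_inv (by simp [nonsing_inv_mul _ hΔ])
    rw [hM, transpose_mul, transpose_mul, transpose_nonsing_inv, hΔs, h]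
    simp [mul_assoc]
  have hMu : IsUnit M := by
    rw [isUnit_iff_isUnit_det, hM, det_mul, det_mul]
    exact (hB.mul ((isUnit_nonsing_inv_det_iff).2 hΔ)).mul hBT
  obtain ⟨p, q, c, hc, hp, hq, hpp, hqq, hpq, hKp, hKq⟩ :=
    exists_orthogonal_pairs_of_skew (Matrix.toEuclideanLin M)
      (fun x y => by
        simp only [EuclideanSpace.inner_eq_star_dotProduct, ofLp_toLpLin, toLin'_apply,
          star_trivial]
        rw [dotProduct_mulVec, ← mulVec_transpose, hMT, neg_mulVec, neg_dotProduct,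
          dotProduct_comm])
      (fun x y h => by
        have h := congrArg WithLp.ofLp h
        simp only [ofLp_toLpLin, toLin'_apply] at h
        exact WithLp.ofLp_injective 2 (mulVec_injective_of_isUnit hMu h))
      s (by simp)
  have hA : ∀ x, (Δ⁻¹ * (Bᵀ * B)) *ᵥ (B⁻¹ *ᵥ x) = B⁻¹ *ᵥ (M *ᵥ x) := by
    intro x
    have h : Δ⁻¹ * (Bᵀ * B) * B⁻¹ = B⁻¹ * M := by
      rw [hM, mul_assoc, mul_assoc Bᵀ, mul_nonsing_inv _ hB, mul_one, mul_assoc,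
        nonsing_inv_mul_cancel_left _ _ hB]
    rw [mulVec_mulVec, mulVec_mulVec, h]
  refine ⟨fun i => B⁻¹ *ᵥ (p i).ofLp, fun i => B⁻¹ *ᵥ (q i).ofLp, c, hc, ?_, ?_, ?_⟩
  · have hli : LinearIndependent ℝ (fun i : Fin (2 * s) =>
        if (i : ℕ) % 2 = 0 then p ⟨(i : ℕ) / 2, by omega⟩ else q ⟨(i : ℕ) / 2, by omega⟩) := by
      refine linearIndependent_of_ne_zero_of_inner_eq_zero (𝕜 := ℝ) ?_ ?_
      · intro i
        split_ifs <;> simp [hp, hq]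
      · intro i j hij
        have hij : (i : ℕ) ≠ j := fun h => hij (Fin.ext h)
        split_ifs
        · exact hpp _ _ (by simp; omega)
        · exact hpq _ _
        · rw [real_inner_comm]
          exact hpq _ _
        · exact hqq _ _ (by simp; omega)
    have hinj : Function.Injective (B⁻¹.mulVecLin ∘ₗ
        (WithLp.linearEquiv 2 ℝ (Fin (2 * s) → ℝ)).toLinearMap) := by
      refine Function.Injective.comp (g := B⁻¹.mulVec) ?_ (LinearEquiv.injective _)
      exact mulVec_injective_of_isUnit
        ((isUnit_iff_isUnit_det _).2 ((isUnit_nonsing_inv_det_iff).2 hB))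
    have h := hli.map' _ (LinearMap.ker_eq_bot.2 hinj)
    refine (congrArg (fun f : Fin (2 * s) → Fin (2 * s) → ℝ => LinearIndependent ℝ f)
      (funext fun i => ?_)).mp h
    simp only [Function.comp_apply]
    split_ifs <;> rfl
  · intro i
    have h := congrArg WithLp.ofLp (hKp i)
    simp only [ofLp_toLpLin, toLin'_apply] at h
    simp [hA, h, mulVec_neg, mulVec_smul]
  · intro i
    have h := congrArg WithLp.ofLp (hKq i)
    simp only [ofLp_toLpLin, toLin'_apply] at h
    simp [hA, h, mulVec_smul]

/-- If `μ` is real symmetric positive definite, `Δ` real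
skew-symmetric nondegenerate, and `μ − (i/2)Δ ≥ 0`, then `Δ⁻¹μ` is similar to the
block-diagonal matrix with blocks `[[0, μ_j],[−μ_j, 0]]` (so has purely imaginary
eigenvalues `±iμ_j`) with `μ_j ≥ 1/2`, and
`det(abs(Δ⁻¹μ) + I/2) = ∏_j (μ_j + 1/2)²`, where `abs(Δ⁻¹μ) = T diag(μ_j,μ_j) T⁻¹`. -/
theorem gaussian_eigenvalue_det
    (s : ℕ) (μ Δ : Matrix (Fin (2 * s)) (Fin (2 * s)) ℝ)
    (hμs : μ.IsSymm) (hμpd : μ.PosDef)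
    (hΔs : Δᵀ = -Δ) (hΔnd : IsUnit Δ.det)
    (hpsd : (μ.map (Complex.ofReal) - (Complex.I / 2) • Δ.map (Complex.ofReal)).PosSemidef) :
    ∃ (T : Matrix (Fin (2 * s)) (Fin (2 * s)) ℝ), IsUnit T.det ∧
      ∃ c : Fin s → ℝ,
        (∀ j, (1 : ℝ) / 2 ≤ c j) ∧
        -- Δ⁻¹μ is similar to the block diagonal matrix with blocks [[0, μ_j],[−μ_j, 0]],
        -- whose eigenvalues are ±iμ_j
        Δ⁻¹ * μ = T * (Matrix.of (fun i j : Fin (2 * s) =>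
            if (j : ℕ) = (i : ℕ) + 1 ∧ (i : ℕ) % 2 = 0 then
              c ⟨(i : ℕ) / 2, by have := i.isLt; omega⟩
            else if (i : ℕ) = (j : ℕ) + 1 ∧ (j : ℕ) % 2 = 0 then
              -(c ⟨(j : ℕ) / 2, by have := j.isLt; omega⟩)
            else 0)) * T⁻¹ ∧
        -- det(abs(Δ⁻¹μ) + I/2) = ∏_j (μ_j + 1/2)², with
        -- abs(Δ⁻¹μ) = T diag(μ_j, μ_j) T⁻¹
        (T * (Matrix.of (fun i j : Fin (2 * s) =>
            if (i : ℕ) = (j : ℕ) then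
              c ⟨(i : ℕ) / 2, by have := i.isLt; omega⟩
            else 0)) * T⁻¹ + (1 / 2 : ℝ) • 1).det
          = ∏ j, (c j + 1 / 2) ^ 2 := by
  obtain ⟨p, q, c, hc, hli, hp, hq⟩ := exists_williamson_columns hμpd hΔs hΔnd
  let T : Matrix (Fin (2 * s)) (Fin (2 * s)) ℝ := (Matrix.of fun i : Fin (2 * s) =>
    if (i : ℕ) % 2 = 0 then p ⟨(i : ℕ) / 2, by omega⟩ else q ⟨(i : ℕ) / 2, by omega⟩)ᵀ
  have hT : IsUnit T.det := by
    rw [← isUnit_iff_isUnit_det, ← linearIndependent_cols_iff_isUnit]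
    exact hli
  refine ⟨T, hT, c, ?_, ?_, ?_⟩
  · intro j
    have hp0 : p j ≠ 0 := by
      have h := hli.ne_zero ⟨2 * j, by omega⟩
      simpa using h
    have hμΔ : ∀ x, μ *ᵥ x = Δ *ᵥ ((Δ⁻¹ * μ) *ᵥ x) := fun x => by
      rw [mulVec_mulVec, mul_nonsing_inv_cancel_left _ _ hΔnd]
    have hμp : p j ⬝ᵥ μ *ᵥ p j = -(c j * (p j ⬝ᵥ Δ *ᵥ q j)) := by
      rw [hμΔ, hp, mulVec_neg, mulVec_smul, dotProduct_neg, dotProduct_smul, smul_eq_mul]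
    have hμq : q j ⬝ᵥ μ *ᵥ q j = -(c j * (p j ⬝ᵥ Δ *ᵥ q j)) := by
      rw [hμΔ, hq, mulVec_smul, dotProduct_smul, smul_eq_mul, dotProduct_mulVec,
        ← mulVec_transpose, hΔs, dotProduct_comm, neg_mulVec, dotProduct_neg, mul_neg]
    have hpos : 0 < p j ⬝ᵥ μ *ᵥ p j := by simpa using hμpd.dotProduct_mulVec_pos hp0
    have hnn := real_nonneg_of_posSemidef hΔs hpsd (p j) (q j)
    rw [hμp] at hpos
    rw [hμp, hμq] at hnn
    have hneg : p j ⬝ᵥ Δ *ᵥ q j < 0 := by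
      by_contra! h
      nlinarith [mul_nonneg (hc j).le h]
    by_contra! h
    nlinarith
  · rw [← mul_nonsing_inv_cancel_right T (Δ⁻¹ * μ) hT]
    congr 1
    ext i ⟨j, hj⟩
    change ((Δ⁻¹ * μ) *ᵥ T.col ⟨j, hj⟩) i = _
    rw [mul_apply]
    obtain h | h := Nat.mod_two_eq_zero_or_one j
    · have hcol : T.col ⟨j, hj⟩ = p ⟨j / 2, by omega⟩ := if_pos h
      have hnext : T.col ⟨j + 1, by omega⟩ = q ⟨j / 2, by omega⟩ := by
        refine (if_neg (by simp; omega)).trans ?_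
        congr 2
        simp
        omega
      rw [hcol, hp, Finset.sum_eq_single ⟨j + 1, by omega⟩]
      · have hTi : T i ⟨j + 1, by omega⟩ = q ⟨j / 2, by omega⟩ i := congrFun hnext i
        rw [hTi, of_apply, if_neg (by simp; omega), if_pos (by simp; omega)]
        simp only [Pi.neg_apply, Pi.smul_apply, smul_eq_mul]
        ring
      · intro k _ hk
        have hk : (k : ℕ) ≠ j + 1 := fun e => hk (Fin.ext e)
        rw [of_apply, if_neg (by simp; omega), if_neg (by simp; omega), mul_zero]
      · simp
    · have hcol : T.col ⟨j, hj⟩ = q ⟨j / 2, by omega⟩ := if_neg (by simp [h])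
      have hprev : T.col ⟨j - 1, by omega⟩ = p ⟨j / 2, by omega⟩ := by
        refine (if_pos (by simp; omega)).trans ?_
        congr 2
        simp
        omega
      rw [hcol, hq, Finset.sum_eq_single ⟨j - 1, by omega⟩]
      · have hTi : T i ⟨j - 1, by omega⟩ = p ⟨j / 2, by omega⟩ i := congrFun hprev i
        have hdiv : (j - 1) / 2 = j / 2 := by omega
        rw [hTi, of_apply, if_pos (by simp; omega)]
        simp [hdiv, mul_comm]
      · intro k _ hk
        have hk : (k : ℕ) ≠ j - 1 := fun e => hk (Fin.ext e)
        rw [of_apply, if_neg (by simp; omega), if_neg (by simp; omega), mul_zero]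
      · simp
  · have h : ∀ D : Matrix (Fin (2 * s)) (Fin (2 * s)) ℝ,
        (T * D * T⁻¹ + (1 / 2 : ℝ) • 1).det = (D + (1 / 2 : ℝ) • 1).det := by
      intro D
      have h1 : T * D * T⁻¹ + (1 / 2 : ℝ) • 1 = T * (D + (1 / 2 : ℝ) • 1) * T⁻¹ := by
        rw [mul_add, add_mul]
        simp [mul_nonsing_inv _ hT]
      rw [h1, det_conj ((isUnit_iff_isUnit_det _).2 hT)]
    rw [h, ← prod_fin_two_mul_div_two s (fun j => c j + 1 / 2), ← det_diagonal]
    congr 1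
    ext i j
    by_cases hij : i = j
    · subst hij
      simp
    · simp [hij, Fin.val_inj]
end
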